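/- arXiv:2605.26693 — 3 statements merged into one kernel-verified Lean document; each statement's English description precedes it below -/
import Mathlib

section
/- Let S ∈ ℝ^{m×p} have orthonormal columns (SᵀS = I_p), let T ≥ 1, let λ_1,…,λ_T be nonnegative real weights, let H_1,…,H_T ∈ ℝ^{m×m} be symmetric positive-semidefinite matrices, let θ_0 ∈ ℝ^m, and for each t let θ_t = θ_0 + δ_t with δ_t ∈ ℝ^m and let the task loss be exactly quadratic: L_t(θ) = L_t(θ_t) + (1/2)(θ − θ_t)ᵀ H_t (θ − θ_t). Set δ̃_t = Sᵀδ_t and δ_t^⊥ = (I_m − SSᵀ)δ_t, fix any δ̃_m ∈ ℝ^p, and let θ_m = θ_0 + S δ̃_m. With V = Σ_{t=1}^T λ_t (δ̃_m − δ̃_t)ᵀ (SᵀH_tS) (δ̃_m − δ̃_t) and R = Σ_{t=1}^T λ_t (δ_t^⊥)ᵀ H_t δ_t^⊥, we have Σ_{t=1}^T λ_t [L_t(θ_m) − L_t(θ_t)] ≤ (1/2)(√V + √R)². -/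
open Matrix Finset

/-- Merging error bound for exactly quadratic task losses: the weighted excess loss of the
lifted merged model `θ_m = θ_0 + S δ̃_m` is at most `(1/2)(√V + √R)²`, where `V` is the
subspace Fréchet variance and `R` the residual energy. -/
theorem merging_error_bound_quadratic
    {m p T : ℕ} (hT : 1 ≤ T)
    (S : Matrix (Fin m) (Fin p) ℝ) (hS : Sᵀ * S = 1)
    (lam : Fin T → ℝ) (hlam : ∀ t, 0 ≤ lam t)
    (H : Fin T → Matrix (Fin m) (Fin m) ℝ) (hH : ∀ t, (H t).PosSemidef)
    (θ0 : Fin m → ℝ) (δ : Fin T → (Fin m → ℝ))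
    (θt : Fin T → (Fin m → ℝ)) (hθt : ∀ t, θt t = θ0 + δ t)
    (L : Fin T → (Fin m → ℝ) → ℝ)
    (hL : ∀ t θ, L t θ = L t (θt t) + (1/2) * ((θ - θt t) ⬝ᵥ ((H t) *ᵥ (θ - θt t))))
    (δm : Fin p → ℝ) (θm : Fin m → ℝ) (hθm : θm = θ0 + S *ᵥ δm) :
    let δt : Fin T → (Fin p → ℝ) := fun t => Sᵀ *ᵥ δ t
    let δperp : Fin T → (Fin m → ℝ) := fun t => (1 - S * Sᵀ) *ᵥ δ t
    let V : ℝ := ∑ t, lam t * ((δm - δt t) ⬝ᵥ ((Sᵀ * H t * S) *ᵥ (δm - δt t)))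
    let R : ℝ := ∑ t, lam t * (δperp t ⬝ᵥ ((H t) *ᵥ δperp t))
    ∑ t, lam t * (L t θm - L t (θt t)) ≤ (1/2) * (Real.sqrt V + Real.sqrt R) ^ 2 := by
  intro δt δperp V R
  let u : Fin T → (Fin m → ℝ) := fun t => S *ᵥ (δm - δt t)
  let c : Fin T → ℝ := fun t => u t ⬝ᵥ (H t *ᵥ δperp t) + δperp t ⬝ᵥ (H t *ᵥ u t)
  let C : ℝ := ∑ t, lam t * c t
  have hV : V = ∑ t, lam t * (u t ⬝ᵥ (H t *ᵥ u t)) := by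
    refine Finset.sum_congr rfl fun t _ => ?_
    congr 1
    simp only [u]
    rw [← Matrix.mulVec_mulVec, ← Matrix.mulVec_mulVec, Matrix.dotProduct_mulVec,
      Matrix.vecMul_transpose]
  have hpsd : ∀ t (v : Fin m → ℝ), 0 ≤ v ⬝ᵥ (H t *ᵥ v) := fun t v => by
    simpa using (hH t).dotProduct_mulVec_nonneg v
  have hV0 : 0 ≤ V := by
    rw [hV]
    exact Finset.sum_nonneg fun t _ => mul_nonneg (hlam t) (hpsd t _)
  have hR0 : 0 ≤ R := Finset.sum_nonneg fun t _ => mul_nonneg (hlam t) (hpsd t _)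
  have hexp : ∀ x : ℝ, ∑ t, lam t * ((x • u t - δperp t) ⬝ᵥ (H t *ᵥ (x • u t - δperp t)))
      = V * (x * x) + (-C) * x + R := by
    intro x
    rw [hV]
    simp only [C, R, c, Finset.sum_mul, ← Finset.sum_neg_distrib, ← Finset.sum_add_distrib]
    refine Finset.sum_congr rfl fun t _ => ?_
    simp only [Matrix.mulVec_sub, Matrix.mulVec_smul, sub_dotProduct, dotProduct_sub,
      smul_dotProduct, dotProduct_smul, smul_eq_mul]
    ring
  have hd := discrim_le_zero (a := V) (b := -C) (c := R) fun x => by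
    rw [← hexp x]
    exact Finset.sum_nonneg fun t _ => mul_nonneg (hlam t) (hpsd t _)
  have hdiff : ∀ t, θm - θt t = (1 : ℝ) • u t - δperp t := by
    intro t
    simp only [u, δperp, δt, hθm, hθt, Matrix.mulVec_sub, Matrix.sub_mulVec, Matrix.one_mulVec,
      Matrix.mulVec_mulVec, one_smul]
    abel
  have hsum : ∑ t, lam t * (L t θm - L t (θt t)) = (1/2) * (V - C + R) := by
    have h1 := hexp 1
    have : V - C + R = V * (1 * 1) + (-C) * 1 + R := by ring
    rw [this, ← h1, Finset.mul_sum]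
    refine Finset.sum_congr rfl fun t _ => ?_
    rw [hL t θm, hdiff t]
    ring
  have hC : -C ≤ 2 * (Real.sqrt V * Real.sqrt R) := by
    refine abs_le_of_sq_le_sq' (b := 2 * (Real.sqrt V * Real.sqrt R)) ?_ (by positivity) |>.2
    have : (2 * (Real.sqrt V * Real.sqrt R)) ^ 2 = 4 * V * R := by
      rw [mul_pow, mul_pow, Real.sq_sqrt hV0, Real.sq_sqrt hR0]
      ring
    rw [this]
    unfold discrim at hd
    linarith
  rw [hsum]
  nlinarith [Real.sq_sqrt hV0, Real.sq_sqrt hR0]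
end

section
/- Let T ≥ 1, let λ_1,…,λ_T be real weights with Σ_{t=1}^T λ_t = 1, let H̃_1,…,H̃_T ∈ ℝ^{p×p} be symmetric matrices with H̄ := Σ_{t=1}^T λ_t H̃_t positive definite, and let δ̃_1,…,δ̃_T ∈ ℝ^p. Define the flat-geometry solution δ_I = δ̄ := Σ_{t=1}^T λ_t δ̃_t, the curvature-aware Fréchet mean δ_H = H̄^{-1} Σ_{t=1}^T λ_t H̃_t δ̃_t, the curvature-task correlation c = Σ_{t=1}^T λ_t (H̃_t − H̄)(δ̃_t − δ̄), and the subspace Fréchet objective F(δ) = Σ_{t=1}^T λ_t (δ − δ̃_t)ᵀ H̃_t (δ − δ̃_t). Then F(δ_I) − F(δ_H) = cᵀ H̄^{-1} c, and this quantity is nonnegative. -/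
open Matrix Finset

/-- Curvature advantage: the improvement of the curvature-aware Fréchet mean `δ_H` over the
flat-geometry solution `δ_I = δ̄` in the subspace Fréchet objective equals `cᵀ H̄⁻¹ c ≥ 0`,
where `c` is the curvature-task correlation. -/
theorem curvature_advantage
    {p T : ℕ} (hT : 1 ≤ T)
    (lam : Fin T → ℝ) (hsum : ∑ t, lam t = 1)
    (Ht : Fin T → Matrix (Fin p) (Fin p) ℝ) (hsymm : ∀ t, (Ht t).IsSymm)
    (hbar : (∑ t, lam t • Ht t).PosDef)
    (δ : Fin T → (Fin p → ℝ))
    (δI : Fin p → ℝ) (hδI : δI = ∑ t, lam t • δ t)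
    (δH : Fin p → ℝ)
    (hδH : δH = (∑ t, lam t • Ht t)⁻¹ *ᵥ (∑ t, lam t • ((Ht t) *ᵥ δ t)))
    (c : Fin p → ℝ)
    (hc : c = ∑ t, lam t • ((Ht t - ∑ s, lam s • Ht s) *ᵥ (δ t - δI)))
    (F : (Fin p → ℝ) → ℝ)
    (hF : ∀ x, F x = ∑ t, lam t * ((x - δ t) ⬝ᵥ ((Ht t) *ᵥ (x - δ t)))) :
    F δI - F δH = c ⬝ᵥ ((∑ t, lam t • Ht t)⁻¹ *ᵥ c) ∧
    0 ≤ c ⬝ᵥ ((∑ t, lam t • Ht t)⁻¹ *ᵥ c) := by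
  obtain ⟨H, hH⟩ : ∃ H, H = ∑ t, lam t • Ht t := ⟨_, rfl⟩
  obtain ⟨b, hb⟩ : ∃ b, b = ∑ t, lam t • ((Ht t) *ᵥ δ t) := ⟨_, rfl⟩
  rw [← hH] at hbar hδH hc ⊢
  rw [← hb] at hδH
  have hdet : IsUnit H.det := hbar.det_pos.ne'.isUnit
  have hsy : ∀ (A : Matrix (Fin p) (Fin p) ℝ), A.IsSymm → ∀ x y : Fin p → ℝ,
      x ⬝ᵥ (A *ᵥ y) = y ⬝ᵥ (A *ᵥ x) := by
    intro A hA x y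
    rw [dotProduct_mulVec, ← mulVec_transpose, hA.eq, dotProduct_comm]
  have hHs : H.IsSymm := by
    have := hbar.isHermitian
    rwa [Matrix.IsHermitian, conjTranspose_eq_transpose_of_trivial] at this
  have hHx : ∀ x, H *ᵥ x = ∑ t, lam t • (Ht t *ᵥ x) := by
    intro x
    rw [hH, Matrix.sum_mulVec]
    simp [smul_mulVec]
  have hHδ : H *ᵥ δH = b := by
    rw [hδH, mulVec_mulVec, mul_nonsing_inv _ hdet, one_mulVec]
  have hcb : c = b - H *ᵥ δI := by
    have h1 : H *ᵥ δI = ∑ t, lam t • (H *ᵥ δ t) := by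
      rw [hδI, mulVec_sum]
      simp [mulVec_smul]
    have h2 : ∑ t, lam t • (H *ᵥ δI) = H *ᵥ δI := by
      rw [← Finset.sum_smul, hsum, one_smul]
    rw [hc]
    simp only [sub_mulVec, mulVec_sub, smul_sub, Finset.sum_sub_distrib]
    rw [h2, ← h1, ← hHx, ← hb]
    abel
  have hinv : H⁻¹ *ᵥ c = δH - δI := by
    rw [hcb, mulVec_sub, ← hδH, mulVec_mulVec, nonsing_inv_mul _ hdet, one_mulVec]
  have hFx : ∀ x, F x = x ⬝ᵥ (H *ᵥ x) - 2 * (x ⬝ᵥ b)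
      + ∑ t, lam t * (δ t ⬝ᵥ (Ht t *ᵥ δ t)) := by
    intro x
    rw [hF, hHx, hb, dotProduct_sum, dotProduct_sum, Finset.mul_sum,
      ← Finset.sum_sub_distrib, ← Finset.sum_add_distrib]
    refine Finset.sum_congr rfl fun t _ => ?_
    simp only [mulVec_sub, dotProduct_sub, sub_dotProduct, dotProduct_smul, smul_eq_mul]
    rw [hsy _ (hsymm t) (δ t) x]
    ring
  constructor
  · rw [hFx, hFx, hinv, hHδ, hcb]
    simp only [dotProduct_sub, sub_dotProduct]
    rw [dotProduct_comm (H *ᵥ δI) δH, hsy H hHs δH δI, hHδ, dotProduct_comm b δH,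
      dotProduct_comm b δI, dotProduct_comm (H *ᵥ δI) δI]
    ring
  · simpa using hbar.inv.posSemidef.dotProduct_mulVec_nonneg c
end

section
/- Let T ≥ 1, let λ_1,…,λ_T be real weights with Σ_{t=1}^T λ_t = 1, let H̃_1,…,H̃_T ∈ ℝ^{p×p} be symmetric matrices with H̄ := Σ_{t=1}^T λ_t H̃_t positive definite, and let δ̃_1,…,δ̃_T ∈ ℝ^p with δ̄ = Σ_t λ_t δ̃_t, δ_H = H̄^{-1} Σ_t λ_t H̃_t δ̃_t, c = Σ_t λ_t (H̃_t − H̄)(δ̃_t − δ̄), and F(δ) = Σ_t λ_t (δ − δ̃_t)ᵀ H̃_t (δ − δ̃_t). Then F(δ̄) = F(δ_H) if and only if c = 0. -/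
open Matrix Finset

/-- Equality case of the curvature advantage: the flat-geometry solution `δ̄` attains the
same subspace Fréchet objective value as the curvature-aware Fréchet mean `δ_H` if and only
if the curvature-task correlation `c` vanishes. -/
theorem curvature_advantage_eq_iff
    {p T : ℕ} (hT : 1 ≤ T)
    (lam : Fin T → ℝ) (hsum : ∑ t, lam t = 1)
    (Ht : Fin T → Matrix (Fin p) (Fin p) ℝ) (hsymm : ∀ t, (Ht t).IsSymm)
    (hbar : (∑ t, lam t • Ht t).PosDef)
    (δ : Fin T → (Fin p → ℝ))
    (δbar : Fin p → ℝ) (hδbar : δbar = ∑ t, lam t • δ t)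
    (δH : Fin p → ℝ)
    (hδH : δH = (∑ t, lam t • Ht t)⁻¹ *ᵥ (∑ t, lam t • ((Ht t) *ᵥ δ t)))
    (c : Fin p → ℝ)
    (hc : c = ∑ t, lam t • ((Ht t - ∑ s, lam s • Ht s) *ᵥ (δ t - δbar)))
    (F : (Fin p → ℝ) → ℝ)
    (hF : ∀ x, F x = ∑ t, lam t * ((x - δ t) ⬝ᵥ ((Ht t) *ᵥ (x - δ t)))) :
    F δbar = F δH ↔ c = 0 := by
  set H : Matrix (Fin p) (Fin p) ℝ := ∑ t, lam t • Ht t with hH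
  have hHv : ∀ v, H *ᵥ v = ∑ t, lam t • (Ht t *ᵥ v) := by
    intro v
    rw [hH, Matrix.sum_mulVec]
    simp only [Matrix.smul_mulVec]
  have hb : H *ᵥ δH = ∑ t, lam t • (Ht t *ᵥ δ t) := by
    have hu : IsUnit H.det := (Matrix.isUnit_iff_isUnit_det _).1 hbar.isUnit
    rw [hδH, Matrix.mulVec_mulVec, Matrix.mul_nonsing_inv _ hu, Matrix.one_mulVec]
  have hHd : H *ᵥ δbar = ∑ t, lam t • (H *ᵥ δ t) := by
    rw [hδbar, Matrix.mulVec_sum]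
    simp only [Matrix.mulVec_smul]
  have hcd : c = H *ᵥ (δH - δbar) := by
    rw [hc]
    have h1 : ∀ t, lam t • ((Ht t - H) *ᵥ (δ t - δbar)) =
        lam t • (Ht t *ᵥ δ t) - lam t • (Ht t *ᵥ δbar) - lam t • (H *ᵥ δ t)
          + lam t • (H *ᵥ δbar) := by
      intro t
      rw [Matrix.sub_mulVec, Matrix.mulVec_sub, Matrix.mulVec_sub]
      module
    simp only [h1, Finset.sum_add_distrib, Finset.sum_sub_distrib]
    rw [← hb, ← hHv, ← hHd, ← Finset.sum_smul, hsum, one_smul, Matrix.mulVec_sub]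
    abel
  have key : F δbar = F δH + (δH - δbar) ⬝ᵥ (H *ᵥ (δH - δbar)) := by
    set d := δH - δbar with hd
    have hx : δbar = δH - d := by rw [hd]; abel
    have h0 : ∑ t, lam t * (d ⬝ᵥ (Ht t *ᵥ (δH - δ t))) = 0 := by
      have : ∑ t, lam t • (Ht t *ᵥ (δH - δ t)) = 0 := by
        simp only [Matrix.mulVec_sub, smul_sub, Finset.sum_sub_distrib]
        rw [← hb, ← hHv, sub_self]
      have h2 := congrArg (fun v => d ⬝ᵥ v) this
      simpa only [dotProduct_sum, dotProduct_smul, smul_eq_mul, dotProduct_zero] using h2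
    have h1 : ∀ t, lam t * ((δbar - δ t) ⬝ᵥ (Ht t *ᵥ (δbar - δ t))) =
        lam t * ((δH - δ t) ⬝ᵥ (Ht t *ᵥ (δH - δ t)))
          - 2 * (lam t * (d ⬝ᵥ (Ht t *ᵥ (δH - δ t)))) + lam t * (d ⬝ᵥ (Ht t *ᵥ d)) := by
      intro t
      have e : δbar - δ t = (δH - δ t) - d := by rw [hx]; abel
      have hs : (δH - δ t) ⬝ᵥ (Ht t *ᵥ d) = d ⬝ᵥ (Ht t *ᵥ (δH - δ t)) := by
        rw [Matrix.dotProduct_mulVec, ← Matrix.mulVec_transpose, (hsymm t).eq, dotProduct_comm]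
      rw [e, Matrix.mulVec_sub (Ht t) (δH - δ t) d, dotProduct_sub, sub_dotProduct (δH - δ t) d,
        sub_dotProduct (δH - δ t) d, hs]
      ring
    rw [hF, hF, hHv]
    simp only [h1, Finset.sum_add_distrib, Finset.sum_sub_distrib, ← Finset.mul_sum, h0,
      dotProduct_sum, dotProduct_smul, smul_eq_mul]
    ring
  constructor
  · intro h
    by_contra hne
    have hd : δH - δbar ≠ 0 := by
      intro h0
      exact hne (by rw [hcd, h0, Matrix.mulVec_zero])
    have := hbar.dotProduct_mulVec_pos hd
    simp only [star_trivial] at this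
    linarith
  · intro h
    rw [key, ← hcd, h, dotProduct_zero, add_zero]
end
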